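/- arXiv:1308.2946 — 2 statements merged into one kernel-verified Lean document; each statement's English description precedes it below -/
import Mathlib

section
/- Let h be a symmetric 3×3 real matrix. The linear endomorphism T_h of the 6-dimensional real vector space Sym₃ of symmetric 3×3 real matrices defined by T_h(π) = 2·h·π·h − tr(h·π)·h satisfies det(T_h) = −32·(det h)⁴. -/
open scoped Matrix

/-- The 6-dimensional real vector space of symmetric `3 × 3` real matrices. -/
def Sym3 : Submodule ℝ (Matrix (Fin 3) (Fin 3) ℝ) where
  carrier := {A | A.IsSymm}
  add_mem' := fun hA hB => hA.add hB
  zero_mem' := Matrix.isSymm_zero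
  smul_mem' := fun c _ hA => hA.smul c

/-- For a symmetric `3 × 3` real matrix `h`, the matrix `2 h π h - tr(h π) h` is
symmetric whenever `π` is. -/
theorem Tmap_mem (h : Matrix (Fin 3) (Fin 3) ℝ) (hs : h.IsSymm) (π : Sym3) :
    ((2 : ℝ) • (h * (π : Matrix (Fin 3) (Fin 3) ℝ) * h)
      - (h * (π : Matrix (Fin 3) (Fin 3) ℝ)).trace • h) ∈ Sym3 := by
  have hπ : (π : Matrix (Fin 3) (Fin 3) ℝ).IsSymm := π.2
  show Matrix.IsSymm _
  unfold Matrix.IsSymm at *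
  simp [Matrix.transpose_sub, Matrix.transpose_smul, Matrix.transpose_mul,
    Matrix.mul_assoc, hs, hπ]

/-- The linear endomorphism `T_h : π ↦ 2 h π h - tr(h π) h` of the space of symmetric
`3 × 3` real matrices. -/
def Tmap (h : Matrix (Fin 3) (Fin 3) ℝ) (hs : h.IsSymm) : Sym3 →ₗ[ℝ] Sym3 where
  toFun π := ⟨(2 : ℝ) • (h * (π : Matrix (Fin 3) (Fin 3) ℝ) * h)
      - (h * (π : Matrix (Fin 3) (Fin 3) ℝ)).trace • h, Tmap_mem h hs π⟩
  map_add' π σ := by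
    apply Subtype.ext
    simp [Matrix.mul_add, Matrix.add_mul, Matrix.trace_add, add_smul, smul_add]
    abel
  map_smul' c π := by
    apply Subtype.ext
    simp [Matrix.mul_smul, Matrix.smul_mul, Matrix.trace_smul, smul_smul, smul_sub,
      mul_comm, smul_comm c]

theorem Matrix.isSymm_conj {m n R : Type*} [Fintype n] [CommSemiring R]
    {A : Matrix n n R} (hA : A.IsSymm) (B : Matrix m n R) : (B * A * Bᵀ).IsSymm := by
  simp [Matrix.IsSymm, Matrix.transpose_mul, Matrix.mul_assoc, hA.eq]

/-- Conjugation `π ↦ Q π Qᵀ` by an orthogonal matrix, as an automorphism of the space of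
symmetric matrices. -/
def Sym3.conjOrthogonal (Q : Matrix (Fin 3) (Fin 3) ℝ) (hQ : Qᵀ * Q = 1) : Sym3 ≃ₗ[ℝ] Sym3 where
  toFun π := ⟨Q * π * Qᵀ, Matrix.isSymm_conj π.2 Q⟩
  invFun π := ⟨Qᵀ * π * Q, Matrix.isSymm_conj π.2 Qᵀ⟩
  map_add' π σ := by
    apply Subtype.ext
    simp [Matrix.mul_add, Matrix.add_mul]
  map_smul' c π := by
    apply Subtype.ext
    simp
  left_inv π := by
    apply Subtype.ext
    calc Qᵀ * (Q * (π : Matrix (Fin 3) (Fin 3) ℝ) * Qᵀ) * Q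
        = (Qᵀ * Q) * π * (Qᵀ * Q) := by simp only [Matrix.mul_assoc]
      _ = π := by simp [hQ]
  right_inv π := by
    have hQ' : Q * Qᵀ = 1 := mul_eq_one_comm.mp hQ
    apply Subtype.ext
    calc Q * (Qᵀ * (π : Matrix (Fin 3) (Fin 3) ℝ) * Q) * Qᵀ
        = (Q * Qᵀ) * π * (Q * Qᵀ) := by simp only [Matrix.mul_assoc]
      _ = π := by simp [hQ']

/-- The determinant of `T_h` is invariant under orthogonal conjugation of `h`. -/
theorem det_Tmap_conj (Q h h' : Matrix (Fin 3) (Fin 3) ℝ) (hQ : Qᵀ * Q = 1)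
    (hs : h.IsSymm) (hs' : h'.IsSymm) (hh : h' = Q * h * Qᵀ) :
    LinearMap.det (Tmap h' hs') = LinearMap.det (Tmap h hs) := by
  rw [← LinearMap.det_conj (Tmap h hs) (Sym3.conjOrthogonal Q hQ)]
  congr 1
  rw [← LinearMap.comp_assoc, LinearEquiv.eq_comp_toLinearMap_symm]
  refine LinearMap.ext fun π => Subtype.ext ?_
  have h₁ : h' * (Q * (π : Matrix (Fin 3) (Fin 3) ℝ) * Qᵀ) = Q * (h * π) * Qᵀ := by
    calc h' * (Q * (π : Matrix (Fin 3) (Fin 3) ℝ) * Qᵀ)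
        = Q * h * (Qᵀ * Q) * π * Qᵀ := by simp only [hh, Matrix.mul_assoc]
      _ = Q * (h * π) * Qᵀ := by simp [hQ, Matrix.mul_assoc]
  have h₂ : Q * (h * (π : Matrix (Fin 3) (Fin 3) ℝ)) * Qᵀ * h' = Q * (h * π * h) * Qᵀ := by
    calc Q * (h * (π : Matrix (Fin 3) (Fin 3) ℝ)) * Qᵀ * h'
        = Q * (h * π) * (Qᵀ * Q) * h * Qᵀ := by simp only [hh, Matrix.mul_assoc]
      _ = Q * (h * π * h) * Qᵀ := by simp [hQ, Matrix.mul_assoc]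
  have h₃ : (Q * (h * (π : Matrix (Fin 3) (Fin 3) ℝ)) * Qᵀ).trace = (h * π).trace := by
    rw [Matrix.trace_mul_comm, ← Matrix.mul_assoc, hQ, Matrix.one_mul]
  change (2 : ℝ) • (h' * (Q * (π : Matrix (Fin 3) (Fin 3) ℝ) * Qᵀ) * h')
      - (h' * (Q * (π : Matrix (Fin 3) (Fin 3) ℝ) * Qᵀ)).trace • h'
    = Q * ((2 : ℝ) • (h * (π : Matrix (Fin 3) (Fin 3) ℝ) * h)
      - (h * (π : Matrix (Fin 3) (Fin 3) ℝ)).trace • h) * Qᵀ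
  rw [h₁, h₂, h₃, hh]
  simp [Matrix.mul_sub, Matrix.sub_mul]

/-- The diagonal and off-diagonal coordinates of a symmetric `3 × 3` matrix. -/
def Sym3.coords : Sym3 ≃ₗ[ℝ] (Fin 3 → ℝ) × (Fin 3 → ℝ) where
  toFun π := (![π.1 0 0, π.1 1 1, π.1 2 2], ![π.1 1 2, π.1 0 2, π.1 0 1])
  invFun v := ⟨!![v.1 0, v.2 2, v.2 1; v.2 2, v.1 1, v.2 0; v.2 1, v.2 0, v.1 2], by
    apply Matrix.IsSymm.ext
    intro i j
    fin_cases i <;> fin_cases j <;> rfl⟩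
  map_add' π σ := by
    ext i <;> fin_cases i <;> rfl
  map_smul' c π := by
    ext i <;> fin_cases i <;> rfl
  left_inv π := by
    have hπ : (π : Matrix (Fin 3) (Fin 3) ℝ).IsSymm := π.2
    apply Subtype.ext
    ext i j
    fin_cases i <;> fin_cases j <;> first | rfl | exact hπ.apply _ _
  right_inv v := by
    ext i <;> fin_cases i <;> rfl

theorem det_Tmap_diagonal (d : Fin 3 → ℝ) :
    LinearMap.det (Tmap (Matrix.diagonal d) (Matrix.isSymm_diagonal d))
      = -32 * (Matrix.diagonal d).det ^ 4 := by
  have key : (Sym3.coords.toLinearMap ∘ₗ Tmap (Matrix.diagonal d) (Matrix.isSymm_diagonal d)) ∘ₗ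
      Sym3.coords.symm.toLinearMap
      = (Matrix.toLin' ((2 : ℝ) • Matrix.diagonal (d ^ 2) - Matrix.vecMulVec d d)).prodMap
        (Matrix.toLin' (Matrix.diagonal ![2 * (d 1 * d 2), 2 * (d 0 * d 2), 2 * (d 0 * d 1)])) := by
    rw [LinearEquiv.comp_toLinearMap_symm_eq]
    refine LinearMap.ext fun π => Prod.ext (funext fun i => ?_) (funext fun i => ?_) <;>
    fin_cases i <;>
    simp [Sym3.coords, Tmap, Matrix.trace, Matrix.vecMulVec_apply, Matrix.mulVec, dotProduct,
      Fin.sum_univ_three, Matrix.diagonal_apply] <;>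
    ring
  rw [← LinearMap.det_conj _ Sym3.coords, ← LinearMap.comp_assoc, key, LinearMap.det_prodMap,
    LinearMap.det_toLin', LinearMap.det_toLin', Matrix.det_diagonal, Matrix.det_diagonal,
    Matrix.det_fin_three]
  simp [Fin.prod_univ_three, Matrix.vecMulVec_apply]
  ring

/-- For every symmetric `3 × 3` real matrix `h`, the determinant of
the endomorphism `T_h (π) = 2 h π h - tr(h π) h` of `Sym₃` equals `-32 (det h)⁴`. -/
theorem det_Tmap (h : Matrix (Fin 3) (Fin 3) ℝ) (hs : h.IsSymm) :
    LinearMap.det (Tmap h hs) = -32 * h.det ^ 4 := by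
  have hh : h.IsHermitian := by
    rw [Matrix.IsHermitian, Matrix.conjTranspose_eq_transpose_of_trivial, hs]
  let Q : Matrix (Fin 3) (Fin 3) ℝ := hh.eigenvectorUnitary.1
  have hQ : Qᵀ * Q = 1 := Unitary.coe_star_mul_self hh.eigenvectorUnitary
  have hd : h = Q * Matrix.diagonal hh.eigenvalues * Qᵀ := hh.spectral_theorem
  have hdet : h.det = (Matrix.diagonal hh.eigenvalues).det := by
    conv_lhs => rw [hd]
    rw [Matrix.det_mul_comm, ← Matrix.mul_assoc, hQ, Matrix.one_mul]
  rw [det_Tmap_conj Q _ h hQ (Matrix.isSymm_diagonal _) hs hd, det_Tmap_diagonal, hdet]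
end

section
/- Let h be a positive-definite symmetric 3×3 real matrix and let N be a real number. The linear endomorphism A of the space Sym₃ of symmetric 3×3 real matrices defined by A(π) = −(N/(2·√(det h)))·(2·h·π·h − tr(h·π)·h) satisfies det(A) = −N⁶·(det h)/2. In particular, |det A| = N⁶·(det h)/2, i.e. |det A| is proportional to N⁶·det h. -/
open scoped Matrix

/-- The ADM kinetic operator `A(π) = -(N/(2 √(det h))) • (2 h π h - tr(h π) h)` as an
endomorphism of the space of symmetric `3 × 3` real matrices. -/
noncomputable def AmapADM (h : Matrix (Fin 3) (Fin 3) ℝ) (hs : h.IsSymm) (N : ℝ) :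
    Sym3 →ₗ[ℝ] Sym3 :=
  (-(N / (2 * Real.sqrt h.det))) • Tmap h hs

/-- Symmetric `3 × 3` matrices in coordinates: the diagonal entries followed by the entries
`(0, 1)`, `(0, 2)`, `(1, 2)` above the diagonal. -/
def Sym3.coordEquiv : Sym3 ≃ₗ[ℝ] (Fin 3 ⊕ Fin 3 → ℝ) where
  toFun π := Sum.elim ![π.1 0 0, π.1 1 1, π.1 2 2] ![π.1 0 1, π.1 0 2, π.1 1 2]
  invFun v := ⟨!![v (.inl 0), v (.inr 0), v (.inr 1);
                  v (.inr 0), v (.inl 1), v (.inr 2);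
                  v (.inr 1), v (.inr 2), v (.inl 2)], by
    show Matrix.IsSymm _
    ext i j
    fin_cases i <;> fin_cases j <;> rfl⟩
  map_add' π σ := by
    ext i
    rcases i with i | i <;> fin_cases i <;> rfl
  map_smul' c π := by
    ext i
    rcases i with i | i <;> fin_cases i <;> rfl
  left_inv π := by
    have hπ : (π : Matrix (Fin 3) (Fin 3) ℝ).IsSymm := π.2
    apply Subtype.ext
    ext i j
    fin_cases i <;> fin_cases j <;> first | rfl | exact hπ.apply _ _
  right_inv v := by
    ext i
    rcases i with i | i <;> fin_cases i <;> rfl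

/-- Congruence `π ↦ U π Uᵀ` by an orthogonal matrix, as an automorphism of the space of symmetric
`3 × 3` matrices. -/
def Sym3.congrEquiv (U : Matrix (Fin 3) (Fin 3) ℝ) (hU : U * Uᵀ = 1) : Sym3 ≃ₗ[ℝ] Sym3 where
  toFun π := ⟨U * π.1 * Uᵀ, by
    have hπ : π.1ᵀ = π.1 := π.2
    show (U * π.1 * Uᵀ)ᵀ = _
    simp [Matrix.mul_assoc, hπ]⟩
  invFun π := ⟨Uᵀ * π.1 * U, by
    have hπ : π.1ᵀ = π.1 := π.2
    show (Uᵀ * π.1 * U)ᵀ = _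
    simp [Matrix.mul_assoc, hπ]⟩
  map_add' π σ := by
    apply Subtype.ext
    simp [Matrix.mul_add, Matrix.add_mul]
  map_smul' c π := by
    apply Subtype.ext
    simp
  left_inv π := by
    have hU' : Uᵀ * U = 1 := mul_eq_one_comm.mp hU
    apply Subtype.ext
    show Uᵀ * (U * π.1 * Uᵀ) * U = π.1
    calc Uᵀ * (U * π.1 * Uᵀ) * U = (Uᵀ * U) * π.1 * (Uᵀ * U) := by simp only [Matrix.mul_assoc]
      _ = π.1 := by simp [hU']
  right_inv π := by
    apply Subtype.ext
    show U * (Uᵀ * π.1 * U) * Uᵀ = π.1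
    calc U * (Uᵀ * π.1 * U) * Uᵀ = (U * Uᵀ) * π.1 * (U * Uᵀ) := by simp only [Matrix.mul_assoc]
      _ = π.1 := by simp [hU]

theorem finrank_Sym3 : Module.finrank ℝ Sym3 = 6 := by
  simp [Sym3.coordEquiv.finrank_eq]

/-- For `h` positive-definite symmetric and `N : ℝ`, the determinant of
the endomorphism `A(π) = -(N/(2 √(det h))) (2 h π h - tr(h π) h)` of `Sym₃` equals
`-N⁶ (det h) / 2`; in particular `|det A| = N⁶ (det h) / 2`. -/
theorem det_AmapADM (h : Matrix (Fin 3) (Fin 3) ℝ) (hs : h.IsSymm) (hpos : h.PosDef)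
    (N : ℝ) :
    LinearMap.det (AmapADM h hs N) = -(N ^ 6 * h.det / 2) ∧
    |LinearMap.det (AmapADM h hs N)| = N ^ 6 * h.det / 2 := by
  have hd : 0 < h.det := hpos.det_pos
  have hsq : Real.sqrt h.det ^ 6 = h.det ^ 3 := by
    rw [show 6 = 2 * 3 from rfl, pow_mul, Real.sq_sqrt hd.le]
  have hdet : LinearMap.det (AmapADM h hs N) = -(N ^ 6 * h.det / 2) := by
    rw [AmapADM, LinearMap.det_smul, finrank_Sym3, det_Tmap, Even.neg_pow (by decide), div_pow,
      mul_pow, hsq]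
    field_simp
    norm_num
  refine ⟨hdet, ?_⟩
  rw [hdet, abs_neg, abs_of_nonneg]
  have := (even_two_mul 3).pow_nonneg N
  positivity
end
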